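/- arXiv:2110.07784 — 2 statements merged into one kernel-verified Lean document; each statement's English description precedes it below -/
import Mathlib

section
/- For every n ≥ 3, the number of permutations σ of [n] avoiding both of the patterns 123 and 132 and in which the entry 1 appears to the left of the entry 2 (i.e., σ^{-1}(1) < σ^{-1}(2)) equals 2^{n−3}. (Equivalently, the generating function F_{12}(x) = Σ_{n≥2} #{σ ∈ S_n({123,132}) : σ^{-1}(1) < σ^{-1}(2)} x^n equals x²(1−x)/(1−2x).) -/
/-- `σ` contains the pattern `τ`. -/
def ContainsPat {n k : ℕ} (σ : Equiv.Perm (Fin n)) (τ : Equiv.Perm (Fin k)) : Prop :=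
  ∃ f : Fin k → Fin n, StrictMono f ∧ ∀ a b : Fin k, σ (f a) < σ (f b) ↔ τ a < τ b

/-- `σ` avoids every pattern in the set `B`. -/
def AvoidsAll {n : ℕ} (B : Set (Σ k, Equiv.Perm (Fin k))) (σ : Equiv.Perm (Fin n)) : Prop :=
  ∀ p ∈ B, ¬ ContainsPat σ p.2

/-- The pattern 123 (0-based one-line notation). -/
noncomputable def p123 : Equiv.Perm (Fin 3) :=
  Equiv.ofBijective ![0, 1, 2] (by decide)

/-- The pattern 132 (0-based one-line notation). -/
noncomputable def p132 : Equiv.Perm (Fin 3) :=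
  Equiv.ofBijective ![0, 2, 1] (by decide)

/-- Elementary reformulation of the conditions. -/
def GoodPerm {n : ℕ} (σ : Equiv.Perm (Fin n)) : Prop :=
  (∀ i j k : Fin n, i < j → i < k → σ i < σ j → σ i < σ k → j = k) ∧
  (∀ i j : Fin n, (σ i).val = 0 → (σ j).val = 1 → i < j)

instance {n : ℕ} (σ : Equiv.Perm (Fin n)) : Decidable (GoodPerm σ) := by
  unfold GoodPerm; infer_instance

theorem avoids_iff {n : ℕ} (σ : Equiv.Perm (Fin n)) :
    AvoidsAll ({⟨3, p123⟩, ⟨3, p132⟩} : Set (Σ k, Equiv.Perm (Fin k))) σ ↔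
    ∀ i j k : Fin n, i < j → i < k → σ i < σ j → σ i < σ k → j = k := by
  have key : ∀ i j k : Fin n, i < j → j < k → σ i < σ j → σ i < σ k →
      ContainsPat σ p123 ∨ ContainsPat σ p132 := by
    intro i j k hij hjk h1 h2
    have hm : StrictMono (![i, j, k] : Fin 3 → Fin n) := by
      intro a b hab
      fin_cases a <;> fin_cases b <;> simp_all [hij.trans hjk]
    have hne : σ j ≠ σ k := fun h => hjk.ne (σ.injective h)
    rcases lt_or_gt_of_ne hne with h | h
    · left
      refine ⟨_, hm, ?_⟩
      intro a b
      fin_cases a <;> fin_cases b <;> simp [p123, h1, h2, h, h1.le, h2.le, h.le]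
    · right
      refine ⟨_, hm, ?_⟩
      intro a b
      fin_cases a <;> fin_cases b <;> simp [p132, h1, h2, h, h1.le, h2.le, h.le]
  constructor
  · intro h i j k hij hik h1 h2
    have ha : ¬ ContainsPat σ p123 := h ⟨3, p123⟩ (by simp)
    have hb : ¬ ContainsPat σ p132 := h ⟨3, p132⟩ (by simp)
    by_contra hne
    rcases lt_or_gt_of_ne hne with hl | hl
    · rcases key i j k hij hl h1 h2 with h | h <;> contradiction
    · rcases key i k j hik hl h2 h1 with h | h <;> contradiction
  · intro h p hp
    simp only [Set.mem_insert_iff, Set.mem_singleton_iff] at hp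
    rcases hp with rfl | rfl
    · rintro ⟨f, hf, hp⟩
      have := h (f 0) (f 1) (f 2) (hf (by decide)) (hf (by decide))
        ((hp 0 1).2 (by simp [p123])) ((hp 0 2).2 (by simp [p123]))
      exact absurd (hf.injective this) (by decide)
    · rintro ⟨f, hf, hp⟩
      have := h (f 0) (f 1) (f 2) (hf (by decide)) (hf (by decide))
        ((hp 0 1).2 (by simp [p132])) ((hp 0 2).2 (by simp [p132]))
      exact absurd (hf.injective this) (by decide)

/-- Insert first entry `v` in front of `τ`. -/
def insPerm {n : ℕ} (p : Fin (n + 1) × Equiv.Perm (Fin n)) : Equiv.Perm (Fin (n + 1)) :=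
  ((finSuccEquiv' 0).trans (Equiv.optionCongr p.2)).trans (finSuccEquiv' p.1).symm

theorem insPerm_zero {n : ℕ} (p : Fin (n + 1) × Equiv.Perm (Fin n)) : insPerm p 0 = p.1 := by
  simp [insPerm]

theorem insPerm_succ {n : ℕ} (p : Fin (n + 1) × Equiv.Perm (Fin n)) (i : Fin n) :
    insPerm p i.succ = p.1.succAbove (p.2 i) := by
  have : finSuccEquiv' (0 : Fin (n+1)) i.succ = some i := by
    rw [← Fin.succAbove_zero, finSuccEquiv'_succAbove]
  simp [insPerm, this]

theorem insPerm_bij (n : ℕ) : Function.Bijective (insPerm (n := n)) := by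
  rw [Fintype.bijective_iff_injective_and_card]
  constructor
  · rintro ⟨v, τ⟩ ⟨w, ρ⟩ h
    have h0 : v = w := by
      have := congrArg (fun e => e 0) h
      simpa [insPerm_zero] using this
    subst h0
    congr 1
    ext1 i
    have := congrArg (fun e => e i.succ) h
    simpa [insPerm_succ] using this
  · simp [Fintype.card_perm, Nat.factorial_succ]

theorem good_ins {n : ℕ} (hn : 3 ≤ n) (p : Fin (n + 1) × Equiv.Perm (Fin n)) :
    GoodPerm (insPerm p) ↔ n - 1 ≤ p.1.val ∧ GoodPerm p.2 := by
  obtain ⟨v, τ⟩ := p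
  have hval : 2 ≤ v.val → ∀ x : Fin n, ((v.succAbove x).val = 0 ↔ x.val = 0) ∧
      ((v.succAbove x).val = 1 ↔ x.val = 1) := by
    intro hv x
    unfold Fin.succAbove
    split_ifs with h <;> simp [Fin.lt_def] at h ⊢ <;> omega
  constructor
  · rintro ⟨h1, h2⟩
    have hv : n - 1 ≤ v.val := by
      by_contra hlt
      have := h1 0 (τ.symm ⟨n-1, by omega⟩).succ (τ.symm ⟨n-2, by omega⟩).succ
        (Fin.succ_pos _) (Fin.succ_pos _)
        (by simp only [insPerm_zero, insPerm_succ, Fin.lt_succAbove_iff_le_castSucc]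
            simp [Fin.le_def]; omega)
        (by simp only [insPerm_zero, insPerm_succ, Fin.lt_succAbove_iff_le_castSucc]
            simp [Fin.le_def]; omega)
      simp at this
      omega
    refine ⟨hv, ?_, ?_⟩
    · intro i j k hij hik hj hk
      have := h1 i.succ j.succ k.succ (by simpa) (by simpa) (by simpa [insPerm_succ])
        (by simpa [insPerm_succ])
      simpa using this
    · intro i j hi hj
      have := h2 i.succ j.succ (by simpa [insPerm_succ] using (hval (by omega) _).1.2 hi)
        (by rw [insPerm_succ]; exact (hval (by omega) _).2.2 hj)
      simpa using this
  · rintro ⟨hv, h1, h2⟩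
    simp only at hv
    refine ⟨?_, ?_⟩
    · intro i j k hij hik hj hk
      obtain ⟨j, rfl⟩ := Fin.exists_succ_eq.2 (Fin.ne_zero_of_lt hij)
      obtain ⟨k, rfl⟩ := Fin.exists_succ_eq.2 (Fin.ne_zero_of_lt hik)
      congr 1
      induction i using Fin.cases with
      | zero =>
        simp only [insPerm_zero, insPerm_succ, Fin.lt_succAbove_iff_le_castSucc] at hj hk
        simp only [Fin.le_def, Fin.val_castSucc] at hj hk
        apply τ.injective
        ext
        omega
      | succ i =>
        simp only [insPerm_succ, Fin.succAbove_lt_succAbove_iff] at hj hk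
        exact h1 i j k (by simpa using hij) (by simpa using hik) hj hk
    · intro i j hi hj
      induction i using Fin.cases with
      | zero => simp only [insPerm_zero] at hi; omega
      | succ i =>
        induction j using Fin.cases with
        | zero => simp only [insPerm_zero] at hj; omega
        | succ j =>
          rw [insPerm_succ] at hi hj
          have := h2 i j ((hval (by omega) _).1.1 hi) ((hval (by omega) _).2.1 hj)
          simpa using this

theorem card_good (n : ℕ) : Nat.card {σ : Equiv.Perm (Fin (n + 3)) // GoodPerm σ} = 2 ^ n := by
  induction n with
  | zero =>
    rw [Nat.card_eq_fintype_card]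
    decide
  | succ n ih =>
    have e1 : {p : Fin (n + 3 + 1) × Equiv.Perm (Fin (n + 3)) //
        n + 3 - 1 ≤ p.1.val ∧ GoodPerm p.2} ≃
        {σ : Equiv.Perm (Fin (n + 3 + 1)) // GoodPerm σ} :=
      (Equiv.ofBijective _ (insPerm_bij (n + 3))).subtypeEquiv
        (fun p => (good_ins (by omega) p).symm)
    have e2 := Equiv.subtypeProdEquivProd (p := fun v : Fin (n + 3 + 1) => n + 3 - 1 ≤ v.val)
      (q := fun τ : Equiv.Perm (Fin (n + 3)) => GoodPerm τ)
    have h2 : Nat.card {v : Fin (n + 3 + 1) // n + 3 - 1 ≤ v.val} = 2 := by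
      rw [Nat.card_eq_fintype_card, Fintype.card_subtype]
      have : (Finset.univ.filter fun v : Fin (n + 3 + 1) => n + 3 - 1 ≤ v.val) =
          Finset.Ici ⟨n + 2, by omega⟩ := by
        ext v; simp [Fin.le_def]
      rw [this, Fin.card_Ici]
      simp
    have := (Nat.card_congr e1).symm.trans (Nat.card_congr e2)
    rw [Nat.card_prod, ih, h2] at this
    rw [pow_succ, mul_comm]
    exact this

theorem card_avoiders_123_132_one_before_two (n : ℕ) (hn : 3 ≤ n) :
    Nat.card {σ : Equiv.Perm (Fin n) //
        AvoidsAll ({⟨3, p123⟩, ⟨3, p132⟩} : Set (Σ k, Equiv.Perm (Fin k))) σ ∧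
        σ.symm ⟨0, by omega⟩ < σ.symm ⟨1, by omega⟩} =
      2 ^ (n - 3) := by
  obtain ⟨m, rfl⟩ := Nat.exists_eq_add_of_le' hn
  rw [Nat.add_sub_cancel, ← card_good m]
  apply Nat.card_congr
  apply Equiv.subtypeEquivRight
  intro σ
  rw [avoids_iff]
  refine and_congr_right fun _ => ?_
  constructor
  · intro h i j hi hj
    have hi' : σ i = ⟨0, by omega⟩ := Fin.ext hi
    have hj' : σ j = ⟨1, by omega⟩ := Fin.ext hj
    rwa [← hi', ← hj', Equiv.symm_apply_apply, Equiv.symm_apply_apply] at h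
  · intro h
    exact h _ _ (by simp) (by simp)
end

section
/- For every n ≥ 1, the number of permutations of [n] avoiding both of the patterns 123 and 2143 equals the Fibonacci number F_{2n−1}. (Equivalently, the generating function Σ_{n≥1} |S_n({123,2143})| x^n equals x(1−x)/(1−3x+x²).) -/
/-- The pattern 2143 (0-based one-line notation). -/
noncomputable def p2143 : Equiv.Perm (Fin 4) :=
  Equiv.ofBijective ![1, 0, 3, 2] (by decide)

/-- Elementary form of avoidance of 123 and 2143. -/
def Av {n : ℕ} (σ : Equiv.Perm (Fin n)) : Prop :=
  (∀ i j k, i < j → j < k → σ i < σ j → σ j < σ k → False) ∧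
  (∀ i j k l, i < j → j < k → k < l → σ j < σ i → σ i < σ l → σ l < σ k → False)

theorem avoidsAll_iff {n : ℕ} (σ : Equiv.Perm (Fin n)) :
    AvoidsAll ({⟨3, p123⟩, ⟨4, p2143⟩} : Set (Σ k, Equiv.Perm (Fin k))) σ ↔ Av σ := by
  have e1 : ∀ a, p123 a = ![0, 1, 2] a := fun a => rfl
  have e2 : ∀ a, p2143 a = ![1, 0, 3, 2] a := fun a => rfl
  constructor
  · intro h
    constructor
    · intro i j k hij hjk h1 h2
      refine h ⟨3, p123⟩ (by simp) ⟨![i, j, k], ?_, ?_⟩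
      · intro a b hab
        fin_cases a <;> fin_cases b <;> simp_all <;> omega
      · intro a b
        simp only [e1]
        fin_cases a <;> fin_cases b <;> simp <;> omega
    · intro i j k l hij hjk hkl h1 h2 h3
      refine h ⟨4, p2143⟩ (by simp) ⟨![i, j, k, l], ?_, ?_⟩
      · intro a b hab
        fin_cases a <;> fin_cases b <;> simp_all <;> omega
      · intro a b
        simp only [e2]
        fin_cases a <;> fin_cases b <;> simp <;> omega
  · rintro ⟨h1, h2⟩ p hp
    simp only [Set.mem_insert_iff, Set.mem_singleton_iff] at hp
    rcases hp with rfl | rfl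
    · rintro ⟨f, hf, h⟩
      simp only [e1] at h
      exact h1 (f 0) (f 1) (f 2) (hf (by decide)) (hf (by decide))
        ((h 0 1).2 (by decide)) ((h 1 2).2 (by decide))
    · rintro ⟨f, hf, h⟩
      simp only [e2] at h
      exact h2 (f 0) (f 1) (f 2) (f 3) (hf (by decide)) (hf (by decide)) (hf (by decide))
        ((h 1 0).2 (by decide)) ((h 0 3).2 (by decide)) ((h 3 2).2 (by decide))

/-- Insert value `q` at position `p`. -/
def ins {n : ℕ} (p q : Fin (n + 1)) (e : Equiv.Perm (Fin n)) : Equiv.Perm (Fin (n + 1)) :=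
  ((finSuccEquiv' p).trans e.optionCongr).trans (finSuccEquiv' q).symm

theorem ins_self {n : ℕ} (p q : Fin (n + 1)) (e : Equiv.Perm (Fin n)) : ins p q e p = q := by
  simp [ins]

theorem ins_above {n : ℕ} (p q : Fin (n + 1)) (e : Equiv.Perm (Fin n)) (i : Fin n) :
    ins p q e (p.succAbove i) = q.succAbove (e i) := by
  simp [ins]

theorem ins_inj {n : ℕ} (p q : Fin (n + 1)) : Function.Injective (ins p q) := by
  intro a b h
  ext1 i
  have := congrArg (fun s => s (p.succAbove i)) h
  simpa [ins_above] using this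

theorem ins_surj {n : ℕ} (p q : Fin (n + 1)) (σ : Equiv.Perm (Fin (n + 1))) (h : σ p = q) :
    ∃ e, ins p q e = σ := by
  have hx : ∀ i : Fin n, ∃ y, q.succAbove y = σ (p.succAbove i) := by
    intro i
    apply Fin.exists_succAbove_eq
    rw [← h]
    exact fun hh => Fin.succAbove_ne p i (σ.injective hh)
  choose g hg using hx
  have gi : Function.Injective g := by
    intro a b hab
    have : σ (p.succAbove a) = σ (p.succAbove b) := by rw [← hg, ← hg, hab]
    exact Fin.succAbove_right_injective (σ.injective this)
  refine ⟨Equiv.ofBijective g (Finite.injective_iff_bijective.1 gi), ?_⟩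
  ext1 i
  rcases Fin.eq_self_or_eq_succAbove p i with rfl | ⟨j, rfl⟩
  · rw [ins_self, h]
  · rw [ins_above, ← hg]; rfl

theorem av_of_ins {n : ℕ} (p q : Fin (n + 1)) (e : Equiv.Perm (Fin n)) (h : Av (ins p q e)) :
    Av e := by
  constructor
  · intro i j k a b c d
    apply h.1 (p.succAbove i) (p.succAbove j) (p.succAbove k) <;>
      simpa [ins_above, Fin.succAbove_lt_succAbove_iff]
  · intro i j k l a b c d f g
    apply h.2 (p.succAbove i) (p.succAbove j) (p.succAbove k) (p.succAbove l) <;>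
      simpa [ins_above, Fin.succAbove_lt_succAbove_iff]

theorem av_ins {n : ℕ} (p q : Fin (n + 1)) (e : Equiv.Perm (Fin n))
    (hpq : (p.val ≤ 1 ∧ q.val = n) ∨ (p.val = 0 ∧ n ≤ q.val + 1)) (h : Av e) :
    Av (ins p q e) := by
  have hs := ins_self p q e
  constructor
  · intro i j k a b c d
    by_cases hi : i = p
    · subst hi; omega
    by_cases hj : j = p
    · subst hj; omega
    by_cases hk : k = p
    · subst hk; omega
    obtain ⟨i, rfl⟩ := Fin.exists_succAbove_eq hi
    obtain ⟨j, rfl⟩ := Fin.exists_succAbove_eq hj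
    obtain ⟨k, rfl⟩ := Fin.exists_succAbove_eq hk
    simp only [ins_above, Fin.succAbove_lt_succAbove_iff] at a b c d
    exact h.1 i j k a b c d
  · intro i j k l a b c d f g
    by_cases hi : i = p
    · subst hi; omega
    by_cases hj : j = p
    · subst hj; omega
    by_cases hk : k = p
    · subst hk; omega
    by_cases hl : l = p
    · subst hl; omega
    obtain ⟨i, rfl⟩ := Fin.exists_succAbove_eq hi
    obtain ⟨j, rfl⟩ := Fin.exists_succAbove_eq hj
    obtain ⟨k, rfl⟩ := Fin.exists_succAbove_eq hk
    obtain ⟨l, rfl⟩ := Fin.exists_succAbove_eq hl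
    simp only [ins_above, Fin.succAbove_lt_succAbove_iff] at a b c d f g
    exact h.2 i j k l a b c d f g

/-- All avoiders. -/
def AA (n : ℕ) : Set (Equiv.Perm (Fin n)) := {σ | Av σ}

/-- Avoiders whose first entry is not the maximum. -/
def GG (n : ℕ) : Set (Equiv.Perm (Fin (n + 1))) := {σ | Av σ ∧ σ 0 ≠ Fin.last n}

theorem AA_succ (n : ℕ) : (AA (n + 1)).ncard = (AA n).ncard + (GG n).ncard := by
  have h : AA (n + 1) = Set.image (ins 0 (Fin.last n)) (AA n) ∪ GG n := by
    ext σ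
    simp only [AA, GG, Set.mem_union, Set.mem_image, Set.mem_ofPred_eq]
    constructor
    · intro h
      by_cases h0 : σ 0 = Fin.last n
      · obtain ⟨e, rfl⟩ := ins_surj _ _ σ h0
        exact Or.inl ⟨e, av_of_ins _ _ _ h, rfl⟩
      · exact Or.inr ⟨h, h0⟩
    · rintro (⟨e, he, rfl⟩ | h)
      · exact av_ins _ _ _ (by simp) he
      · exact h.1
  rw [h, Set.ncard_union_eq, Set.ncard_image_of_injective _ (ins_inj _ _)]
  rw [Set.disjoint_left]
  rintro _ ⟨e, _, rfl⟩ h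
  exact h.2 (ins_self _ _ _)

theorem GG_succ (n : ℕ) : (GG (n + 1)).ncard = (AA (n + 1)).ncard + (GG n).ncard := by
  have h : GG (n + 1) = Set.image (ins 1 (Fin.last (n + 1))) (AA (n + 1)) ∪
      Set.image (ins 0 (Fin.last n).castSucc) (GG n) := by
    ext σ
    simp only [AA, GG, Set.mem_union, Set.mem_image, Set.mem_ofPred_eq]
    constructor
    · rintro ⟨h, h0⟩
      by_cases h1 : σ 1 = Fin.last (n + 1)
      · obtain ⟨e, rfl⟩ := ins_surj _ _ σ h1
        exact Or.inl ⟨e, av_of_ins _ _ _ h, rfl⟩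
      · have h2 : σ 0 = (Fin.last n).castSucc := by
          by_contra h2
          obtain ⟨p, hp⟩ := σ.surjective (Fin.last (n + 1))
          obtain ⟨q, hq⟩ := σ.surjective (Fin.last n).castSucc
          have hp0 : p ≠ 0 := by rintro rfl; exact h0 hp
          have hp1 : p ≠ 1 := by rintro rfl; exact h1 hp
          have hq0 : q ≠ 0 := by rintro rfl; exact h2 hq
          have hpq : p ≠ q := by
            rintro rfl
            rw [hp] at hq
            simp [Fin.ext_iff] at hq
          have h01 : σ 0 ≠ σ 1 := fun hh => by simpa using σ.injective hh
          simp only [ne_eq, Fin.ext_iff, Fin.val_last, Fin.val_castSucc, Fin.val_zero,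
            Fin.val_one] at *
          have a1 := h.1 0 1 p
          have a2 := h.1 0 q p
          have a3 := h.2 0 1 p q
          simp only [Fin.lt_def, Fin.val_zero, Fin.val_one] at a1 a2 a3
          have := (σ 0).isLt
          have := (σ 1).isLt
          grind
        obtain ⟨e, rfl⟩ := ins_surj _ _ σ h2
        refine Or.inr ⟨e, ⟨av_of_ins _ _ _ h, ?_⟩, rfl⟩
        intro he
        apply h1
        have := ins_above 0 (Fin.last n).castSucc e 0
        rw [he] at this
        simpa [Fin.succAbove] using this
    · rintro (⟨e, he, rfl⟩ | ⟨e, ⟨he, h0⟩, rfl⟩)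
      · refine ⟨av_ins _ _ _ (by simp) he, fun h => ?_⟩
        have := (ins 1 (Fin.last (n + 1)) e).injective (h.trans (ins_self _ _ _).symm)
        simp at this
      · refine ⟨av_ins _ _ _ (by simp) he, ?_⟩
        rw [ins_self]
        simp [Fin.ext_iff]
  rw [h, Set.ncard_union_eq, Set.ncard_image_of_injective _ (ins_inj _ _),
    Set.ncard_image_of_injective _ (ins_inj _ _)]
  rw [Set.disjoint_left]
  rintro _ ⟨e, _, rfl⟩ ⟨e', h, he⟩
  apply h.2
  have a := ins_self 1 (Fin.last (n + 1)) e
  rw [← he] at a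
  have b := ins_above 0 (Fin.last n).castSucc e' 0
  have c : (0 : Fin (n + 2)).succAbove 0 = 1 := by simp
  rw [c, a] at b
  by_contra hne
  have hlt := Fin.lt_last_iff_ne_last.2 hne
  rw [Fin.succAbove_of_castSucc_lt _ _ (by simpa [Fin.lt_def] using hlt)] at b
  simp only [Fin.ext_iff, Fin.val_last, Fin.val_castSucc] at b
  omega

theorem counts (n : ℕ) : (AA (n + 1)).ncard = Nat.fib (2 * n + 1) ∧
    (GG n).ncard = Nat.fib (2 * n) := by
  induction n with
  | zero =>
    have hG : GG 0 = ∅ := by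
      ext σ
      simp only [GG, Set.mem_ofPred_eq, Set.mem_empty_iff_false, iff_false]
      exact fun h => h.2 (Fin.ext (by omega))
    have hA : AA 0 = {1} := by
      ext σ
      simp only [AA, Set.mem_ofPred_eq, Set.mem_singleton_iff]
      exact ⟨fun _ => Subsingleton.elim _ _, fun _ => ⟨fun i => i.elim0, fun i => i.elim0⟩⟩
    rw [AA_succ, hG, hA]
    simp
  | succ n ih =>
    have h1 : (GG (n + 1)).ncard = Nat.fib (2 * (n + 1)) := by
      rw [GG_succ, ih.1, ih.2, mul_add, mul_one, Nat.fib_add_two, add_comm]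
    refine ⟨?_, h1⟩
    rw [AA_succ, ih.1, h1, show 2 * (n + 1) + 1 = (2 * n + 1) + 2 by ring, Nat.fib_add_two]
    rfl

theorem card_avoiders_123_2143 (n : ℕ) (hn : 1 ≤ n) :
    Nat.card {σ : Equiv.Perm (Fin n) //
        AvoidsAll ({⟨3, p123⟩, ⟨4, p2143⟩} : Set (Σ k, Equiv.Perm (Fin k))) σ} =
      Nat.fib (2 * n - 1) := by
  obtain ⟨m, rfl⟩ : ∃ m, n = m + 1 := ⟨n - 1, by omega⟩
  simp only [avoidsAll_iff]
  exact (counts m).1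
end
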